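/- Intermediate high-probability bound from the proof of the main theorem: with probability at least 1 − δ over the draw of the samples S_1, …, S_N, the minimizer ĥ_α of the α-weighted empirical risk satisfies ε_T(ĥ_α) ≤ ε̂_α(ĥ_α) + 2 Σ_{i=1}^N α_i R_i(H) + 3 √(log(4/δ) M² / 2) · √(Σ_{i=1}^N α_i² / m_i) + Σ_{i=1}^N α_i d_H(D_i, D_T). -/

import Mathlib

open MeasureTheory

noncomputable section

/-- A Rademacher sign encoded by a Boolean. -/
def radSign (b : Bool) : ℝ := if b then 1 else -1

variable {X Y : Type*} [MeasurableSpace X] [MeasurableSpace Y]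

/-- Expected risk of a predictor `f` under a distribution `P` on `X × Y`. -/
def expRisk (L : Y → Y → ℝ) (P : Measure (X × Y)) (f : X → Y) : ℝ :=
  ∫ z, L (f z.1) z.2 ∂P

/-- The α-weighted empirical risk of `f` on the samples `S`. -/
def empRisk {N : ℕ} (L : Y → Y → ℝ) (m : Fin N → ℕ) (α : Fin N → ℝ)
    (S : (i : Fin N) → Fin (m i) → X × Y) (f : X → Y) : ℝ :=
  ∑ i, (α i / (m i : ℝ)) * ∑ j, L (f (S i j).1) (S i j).2

/-- Joint distribution of the samples: for each source `i`, `m i` i.i.d. draws from `D i`,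
all sources mutually independent. -/
def sampleMeasure {N : ℕ} (m : Fin N → ℕ) (D : Fin N → Measure (X × Y)) :
    Measure ((i : Fin N) → Fin (m i) → X × Y) :=
  Measure.pi fun i => Measure.pi fun _ => D i

/-- Joint distribution of the i.i.d. Rademacher signs (encoded as Booleans). -/
def radMeasure (N : ℕ) (m : Fin N → ℕ) : Measure ((i : Fin N) → Fin (m i) → Bool) :=
  Measure.pi fun _ => Measure.pi fun _ => (PMF.uniformOfFintype Bool).toMeasure

/-- Data-dependent Rademacher complexity of source `i`. -/
def radComplexity {ι : Type*} {N : ℕ} (L : Y → Y → ℝ) (h : ι → X → Y) (m : Fin N → ℕ)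
    (S : (i : Fin N) → Fin (m i) → X × Y) (i : Fin N) : ℝ :=
  ∫ σ, (⨆ k, (1 / (m i : ℝ)) * ∑ j, radSign (σ i j) * L (h k (S i j).1) (S i j).2)
    ∂(radMeasure N m)

/-- Discrepancy between two distributions with respect to the hypothesis class `h`. -/
def discrepancy {ι : Type*} (L : Y → Y → ℝ) (h : ι → X → Y) (P Q : Measure (X × Y)) : ℝ :=
  ⨆ k, |expRisk L P (h k) - expRisk L Q (h k)|

lemma integrable_of_bdd {Ω : Type*} [MeasurableSpace Ω] {μ : Measure Ω} [IsFiniteMeasure μ]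
    {f : Ω → ℝ} (hf : Measurable f) {B : ℝ} (hB : ∀ x, |f x| ≤ B) : Integrable f μ :=
  Integrable.of_bound hf.aestronglyMeasurable B (Filter.Eventually.of_forall hB)

/-- Lipschitz functions have sub-Gaussian moment generating function. -/
def SubG {Ω : Type*} [MeasurableSpace Ω] (μ : Measure Ω) (d : Ω → Ω → ℝ) (V : ℝ) : Prop :=
  ∀ f : Ω → ℝ, Measurable f → (∃ B, ∀ x, |f x| ≤ B) → (∀ x y, f x - f y ≤ d x y) →
    ∀ t : ℝ, ∫ x, Real.exp (t * f x) ∂μ ≤ Real.exp (t * ∫ x, f x ∂μ + V * t ^ 2 / 2)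

lemma bdd_exp {Ω : Type*} {f : Ω → ℝ} {B : ℝ} (hB : ∀ x, |f x| ≤ B) (t : ℝ) (x : Ω) :
    |Real.exp (t * f x)| ≤ Real.exp (|t| * B) := by
  rw [abs_of_pos (Real.exp_pos _)]
  apply Real.exp_le_exp.2
  calc t * f x ≤ |t * f x| := le_abs_self _
    _ = |t| * |f x| := abs_mul _ _
    _ ≤ |t| * B := by gcongr; exact hB x

open Classical in
lemma SubG.base {Ω : Type*} [MeasurableSpace Ω] (μ : Measure Ω) [IsProbabilityMeasure μ]
    (c : ℝ) (hc : 0 ≤ c) : SubG μ (fun x y => if x = y then 0 else c) (c ^ 2 / 4) := by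
  intro f hf ⟨B, hB⟩ hd t
  have hd' : ∀ x y, f x - f y ≤ c := by
    intro x y
    refine (hd x y).trans ?_
    dsimp only
    split_ifs
    · exact hc
    · exact le_rfl
  have hne : Nonempty Ω := μ.nonempty_of_neZero
  have hbdd : BddBelow (Set.range f) := ⟨-B, by rintro _ ⟨x, rfl⟩; exact (abs_le.1 (hB x)).1⟩
  set a := ⨅ x, f x
  have hmem : ∀ᵐ ω ∂μ, f ω ∈ Set.Icc a (a + c) := by
    refine Filter.Eventually.of_forall fun x => ⟨ciInf_le hbdd x, ?_⟩
    have : f x - c ≤ a := le_ciInf fun y => by linarith [hd' x y]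
    linarith
  have h := (ProbabilityTheory.hasSubgaussianMGF_of_mem_Icc hf.aemeasurable hmem).mgf_le t
  have hV : (((‖a + c - a‖₊ / 2) ^ 2 : NNReal) : ℝ) = c ^ 2 / 4 := by
    push_cast
    rw [Real.norm_eq_abs, add_sub_cancel_left, abs_of_nonneg hc]
    ring
  rw [hV] at h
  unfold ProbabilityTheory.mgf at h
  have e : ∀ x, Real.exp (t * f x) =
      Real.exp (t * ∫ x, f x ∂μ) * Real.exp (t * (f x - ∫ x, f x ∂μ)) := by
    intro x; rw [← Real.exp_add]; congr 1; ring
  simp_rw [e]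
  rw [integral_const_mul, Real.exp_add]
  gcongr

lemma SubG.prod {Ω₁ Ω₂ : Type*} [MeasurableSpace Ω₁] [MeasurableSpace Ω₂]
    {μ : Measure Ω₁} {ν : Measure Ω₂} [IsProbabilityMeasure μ] [IsProbabilityMeasure ν]
    {d₁ : Ω₁ → Ω₁ → ℝ} {d₂ : Ω₂ → Ω₂ → ℝ} {V₁ V₂ : ℝ}
    (h₁ : SubG μ d₁ V₁) (h₂ : SubG ν d₂ V₂) (h1 : ∀ x, d₁ x x = 0) (h2 : ∀ x, d₂ x x = 0) :
    SubG (μ.prod ν) (fun p q => d₁ p.1 q.1 + d₂ p.2 q.2) (V₁ + V₂) := by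
  intro f hf ⟨B, hB⟩ hd t
  have hfi : Integrable f (μ.prod ν) := integrable_of_bdd hf hB
  have hfx : ∀ x, Integrable (fun y => f (x, y)) ν := fun x =>
    integrable_of_bdd (hf.comp measurable_prodMk_left) (fun y => hB _)
  have hem : Measurable fun p => Real.exp (t * f p) := by fun_prop
  have hei : Integrable (fun p => Real.exp (t * f p)) (μ.prod ν) :=
    integrable_of_bdd hem (bdd_exp hB t)
  rw [integral_prod _ hei, integral_prod _ hfi]
  set g : Ω₁ → ℝ := fun x => ∫ y, f (x, y) ∂ν with hg
  have hgm : Measurable g := (hf.stronglyMeasurable.integral_prod_right' (ν := ν)).measurable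
  have hgB : ∀ x, |g x| ≤ B := by
    intro x
    have := norm_integral_le_of_norm_le_const (μ := ν) (f := fun y => f (x, y)) (C := B)
      (Filter.Eventually.of_forall fun y => hB _)
    simpa using this
  have hgd : ∀ x y, g x - g y ≤ d₁ x y := by
    intro x y
    rw [hg]
    simp only
    rw [← integral_sub (hfx x) (hfx y)]
    have : ∫ z, (f (x, z) - f (y, z)) ∂ν ≤ ∫ z, d₁ x y ∂ν := by
      apply integral_mono ((hfx x).sub (hfx y)) (integrable_const _)
      intro z
      have := hd (x, z) (y, z)
      simpa [h2] using this
    simpa using this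
  have hstep : ∀ x, ∫ y, Real.exp (t * f (x, y)) ∂ν ≤
      Real.exp (t * g x) * Real.exp (V₂ * t ^ 2 / 2) := by
    intro x
    rw [← Real.exp_add]
    refine h₂ (fun y => f (x, y)) (hf.comp measurable_prodMk_left) ⟨B, fun y => hB _⟩ ?_ t
    intro y z
    have := hd (x, y) (x, z)
    simpa [h1] using this
  calc ∫ x, ∫ y, Real.exp (t * f (x, y)) ∂ν ∂μ
      ≤ ∫ x, Real.exp (t * g x) * Real.exp (V₂ * t ^ 2 / 2) ∂μ := by
        apply integral_mono hei.integral_prod_left _ hstep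
        apply Integrable.mul_const
        exact integrable_of_bdd (by fun_prop) (bdd_exp hgB t)
    _ = (∫ x, Real.exp (t * g x) ∂μ) * Real.exp (V₂ * t ^ 2 / 2) := integral_mul_const _ _
    _ ≤ Real.exp (t * ∫ x, g x ∂μ + V₁ * t ^ 2 / 2) * Real.exp (V₂ * t ^ 2 / 2) := by
        gcongr
        exact h₁ g hgm ⟨B, hgB⟩ hgd t
    _ = _ := by rw [← Real.exp_add]; congr 1; ring

lemma SubG.pi {n : ℕ} {Ω : Fin n → Type*} [∀ i, MeasurableSpace (Ω i)]
    (μ : ∀ i, Measure (Ω i)) [∀ i, IsProbabilityMeasure (μ i)]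
    (d : ∀ i, Ω i → Ω i → ℝ) (V : Fin n → ℝ) (h : ∀ i, SubG (μ i) (d i) (V i))
    (hd0 : ∀ i x, d i x x = 0) :
    SubG (Measure.pi μ) (fun x y => ∑ i, d i (x i) (y i)) (∑ i, V i) := by
  induction n with
  | zero =>
    intro f hf _ _ t
    have : ∀ x, f x = f default := fun x => congrArg f (Subsingleton.elim _ _)
    simp_rw [this]
    simp
  | succ n ih =>
    have ih' := ih (fun j => μ (Fin.succAbove 0 j)) (fun j => d (Fin.succAbove 0 j))
      (fun j => V (Fin.succAbove 0 j)) (fun j => h _) (fun j => hd0 _)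
    have hp := (h 0).prod ih' (hd0 0) (fun x => Finset.sum_eq_zero fun i _ => hd0 _ _)
    intro f hf ⟨B, hB⟩ hd t
    have mp := measurePreserving_piFinSuccAbove μ 0
    set e := MeasurableEquiv.piFinSuccAbove Ω 0 with he
    have key := hp (f ∘ e.symm) (hf.comp e.symm.measurable) ⟨B, fun x => hB _⟩ ?_ t
    · rw [← mp.integral_comp', ← mp.integral_comp'] at key
      simp only [Function.comp, MeasurableEquiv.symm_apply_apply] at key
      rw [Fin.sum_univ_succ]
      simpa using key
    · intro x y
      refine (hd _ _).trans (le_of_eq ?_)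
      dsimp only
      rw [Fin.sum_univ_succAbove _ 0]
      obtain ⟨x, rfl⟩ := e.surjective x
      obtain ⟨y, rfl⟩ := e.surjective y
      simp only [MeasurableEquiv.symm_apply_apply]
      rfl

lemma mp_split {ι : Type*} [Fintype ι] {Ω : ι → Type*} [∀ i, MeasurableSpace (Ω i)]
    (μ : ∀ i, Measure (Ω i)) [∀ i, IsProbabilityMeasure (μ i)] :
    MeasurePreserving (fun p : (∀ i, Ω i × Ω i) => ((fun i => (p i).1), (fun i => (p i).2)))
      (Measure.pi fun i => (μ i).prod (μ i)) ((Measure.pi μ).prod (Measure.pi μ)) := by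
  have hm : Measurable (fun p : (∀ i, Ω i × Ω i) => ((fun i => (p i).1), (fun i => (p i).2))) := by
    fun_prop
  refine ⟨hm, ?_⟩
  symm
  refine Measure.prod_eq_generateFrom generateFrom_pi generateFrom_pi isPiSystem_pi isPiSystem_pi
    (Measure.FiniteSpanningSetsIn.pi fun i => (μ i).toFiniteSpanningSetsIn)
    (Measure.FiniteSpanningSetsIn.pi fun i => (μ i).toFiniteSpanningSetsIn) ?_
  rintro _ ⟨s, hs, rfl⟩ _ ⟨t, ht, rfl⟩
  rw [Measure.map_apply hm]
  · rw [show (fun p : (∀ i, Ω i × Ω i) => ((fun i => (p i).1), (fun i => (p i).2))) ⁻¹'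
        (Set.univ.pi s ×ˢ Set.univ.pi t) = Set.univ.pi fun i => s i ×ˢ t i by
          ext; simp [Set.mem_pi, forall_and]]
    simp_rw [Measure.pi_pi, Measure.prod_prod, Finset.prod_mul_distrib]
  · exact (MeasurableSet.univ_pi fun i => hs i trivial).prod
      (MeasurableSet.univ_pi fun i => ht i trivial)

lemma mp_unsplit {ι : Type*} [Fintype ι] {Ω : ι → Type*} [∀ i, MeasurableSpace (Ω i)]
    (μ : ∀ i, Measure (Ω i)) [∀ i, IsProbabilityMeasure (μ i)] :
    MeasurePreserving (fun (q : (∀ i, Ω i) × (∀ i, Ω i)) i => (q.1 i, q.2 i))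
      ((Measure.pi μ).prod (Measure.pi μ)) (Measure.pi fun i => (μ i).prod (μ i)) := by
  have hm : Measurable (fun (q : (∀ i, Ω i) × (∀ i, Ω i)) i => (q.1 i, q.2 i)) := by
    fun_prop
  refine ⟨hm, ?_⟩
  rw [← (mp_split μ).map_eq, Measure.map_map hm (mp_split μ).measurable]
  exact Measure.map_id

lemma mp_combine {ι : Type*} [Fintype ι] {Ω : ι → Type*} [∀ i, MeasurableSpace (Ω i)]
    (μ : ∀ i, Measure (Ω i)) [∀ i, IsProbabilityMeasure (μ i)]
    (e : ∀ i, Ω i × Ω i → Ω i × Ω i)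
    (he : ∀ i, MeasurePreserving (e i) ((μ i).prod (μ i)) ((μ i).prod (μ i))) :
    MeasurePreserving (fun q : (∀ i, Ω i) × (∀ i, Ω i) =>
        ((fun i => (e i (q.1 i, q.2 i)).1), (fun i => (e i (q.1 i, q.2 i)).2)))
      ((Measure.pi μ).prod (Measure.pi μ)) ((Measure.pi μ).prod (Measure.pi μ)) :=
  (mp_split μ).comp ((measurePreserving_pi _ _ he).comp (mp_unsplit μ))

section aux
variable {ι : Type*} [Nonempty ι]

lemma bddAbove_of_abs {a : ι → ℝ} {C : ℝ} (h : ∀ k, |a k| ≤ C) : BddAbove (Set.range a) :=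
  ⟨C, by rintro _ ⟨k, rfl⟩; exact (abs_le.1 (h k)).2⟩

lemma abs_iSup_le_of {a : ι → ℝ} {C : ℝ} (h : ∀ k, |a k| ≤ C) : |⨆ k, a k| ≤ C := by
  obtain ⟨k₀⟩ := ‹Nonempty ι›
  haveI : Nonempty ι := ⟨k₀⟩
  refine abs_le.2 ⟨?_, ciSup_le fun k => (abs_le.1 (h k)).2⟩
  exact (abs_le.1 (h k₀)).1.trans (le_ciSup (bddAbove_of_abs h) k₀)

lemma iSup_sub_le {a b : ι → ℝ} {C d : ℝ} (hb : ∀ k, |b k| ≤ C) (h : ∀ k, a k - b k ≤ d) :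
    (⨆ k, a k) - ⨆ k, b k ≤ d := by
  have : ⨆ k, a k ≤ (⨆ k, b k) + d := ciSup_le fun k => by
    linarith [h k, le_ciSup (bddAbove_of_abs hb) k]
  linarith

lemma abs_integral_le_of {Ω : Type*} [MeasurableSpace Ω] {μ : Measure Ω} [IsProbabilityMeasure μ]
    {f : Ω → ℝ} {C : ℝ} (h : ∀ x, |f x| ≤ C) : |∫ x, f x ∂μ| ≤ C := by
  have := norm_integral_le_of_norm_le_const (μ := μ) (f := f) (C := C)
      (Filter.Eventually.of_forall fun y => h y)
  simpa using this

lemma sym1 [Countable ι] {Ω : Type*} [MeasurableSpace Ω] (μ : Measure Ω) [IsProbabilityMeasure μ]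
    (W W' : ι → Ω → ℝ) (hW : ∀ k, Measurable (W k)) (hW' : ∀ k, Measurable (W' k)) (C : ℝ)
    (hC : ∀ k x, |W k x| ≤ C) (hC' : ∀ k x, |W' k x| ≤ C)
    (T : Ω × Ω → Ω × Ω) (hT : MeasurePreserving T (μ.prod μ) (μ.prod μ))
    (hTW : ∀ k q, W k (T q).2 - W k (T q).1 = W' k q.2 - W' k q.1) :
    ∫ x, ⨆ k, (∫ y, W k y ∂μ - W k x) ∂μ ≤ ∫ x, ⨆ k, W' k x ∂μ + ∫ x, ⨆ k, - W' k x ∂μ := by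
  have b2 : ∀ k x y, |W k y - W k x| ≤ 2 * C := fun k x y => by
    have := abs_le.1 (hC k x); have := abs_le.1 (hC k y)
    exact abs_le.2 ⟨by linarith, by linarith⟩
  have b2' : ∀ k x y, |W' k y - W' k x| ≤ 2 * C := fun k x y => by
    have := abs_le.1 (hC' k x); have := abs_le.1 (hC' k y)
    exact abs_le.2 ⟨by linarith, by linarith⟩
  have b3 : ∀ k x, |∫ y, W k y ∂μ - W k x| ≤ 2 * C := fun k x => by
    have := abs_le.1 (hC k x); have := abs_le.1 (abs_integral_le_of (μ := μ) (hC k))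
    exact abs_le.2 ⟨by linarith, by linarith⟩
  have hWi : ∀ k, Integrable (W k) μ := fun k => integrable_of_bdd (hW k) (hC k)
  set g : Ω × Ω → ℝ := fun q => ⨆ k, (W k q.2 - W k q.1) with hg
  have hgm : Measurable g := Measurable.iSup fun k => by
    have := hW k; fun_prop
  have hgB : ∀ q, |g q| ≤ 2 * C := fun q => abs_iSup_le_of fun k => b2 k _ _
  have hgi : Integrable g (μ.prod μ) := integrable_of_bdd hgm hgB
  have hgx : ∀ x, Integrable (fun y => g (x, y)) μ := fun x =>
    integrable_of_bdd (hgm.comp measurable_prodMk_left) (fun y => hgB _)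
  have m1 : Measurable fun x => ⨆ k, W' k x := Measurable.iSup hW'
  have m2 : Measurable fun x => ⨆ k, - W' k x := Measurable.iSup fun k => (hW' k).neg
  have i1 : Integrable (fun x => ⨆ k, W' k x) μ :=
    integrable_of_bdd m1 fun x => abs_iSup_le_of fun k => hC' k x
  have hCn : ∀ k x, |- W' k x| ≤ C := fun k x => by rw [abs_neg]; exact hC' k x
  have i2 : Integrable (fun x => ⨆ k, - W' k x) μ :=
    integrable_of_bdd m2 fun x => abs_iSup_le_of fun k => hCn k x
  calc ∫ x, ⨆ k, (∫ y, W k y ∂μ - W k x) ∂μ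
      ≤ ∫ x, ∫ y, g (x, y) ∂μ ∂μ := by
        refine integral_mono ?_ hgi.integral_prod_left ?_
        · refine integrable_of_bdd (Measurable.iSup fun k => ?_)
            (fun x => abs_iSup_le_of fun k => b3 k x)
          exact measurable_const.sub (hW k)
        · intro x
          refine ciSup_le fun k => ?_
          have e : ∫ y, W k y ∂μ - W k x = ∫ y, (W k y - W k x) ∂μ := by
            rw [integral_sub (hWi k) (integrable_const _)]; simp
          rw [e]
          refine integral_mono ((hWi k).sub (integrable_const _)) (hgx x) fun y => ?_
          exact le_ciSup (bddAbove_of_abs fun k => b2 k x y) k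
    _ = ∫ q, g q ∂(μ.prod μ) := (integral_prod _ hgi).symm
    _ = ∫ q, g (T q) ∂(μ.prod μ) := by
        conv_lhs => rw [← hT.map_eq]
        exact integral_map hT.measurable.aemeasurable hgm.aestronglyMeasurable
    _ ≤ ∫ q : Ω × Ω, ((⨆ k, W' k q.2) + ⨆ k, - W' k q.1) ∂(μ.prod μ) := by
        refine integral_mono (integrable_of_bdd (hgm.comp hT.measurable) fun q => hgB _)
          ((i1.comp_snd μ).add (i2.comp_fst μ)) fun q => ?_
        refine ciSup_le fun k => ?_
        rw [hTW]
        have := le_ciSup (bddAbove_of_abs fun k => hC' k q.2) k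
        have := le_ciSup (bddAbove_of_abs fun k => hCn k q.1) k
        linarith
    _ = _ := by
        rw [integral_add (i1.comp_snd μ) (i2.comp_fst μ)]
        rw [integral_fun_snd (μ := μ) (ν := μ) (fun x => ⨆ k, W' k x),
          integral_fun_fst (μ := μ) (ν := μ) (fun x => ⨆ k, - W' k x)]
        simp

end aux

instance radMeasure_prob (N : ℕ) (m : Fin N → ℕ) : IsProbabilityMeasure (radMeasure N m) := by
  unfold radMeasure; infer_instance

instance sampleMeasure_prob {Z W : Type*} [MeasurableSpace Z] [MeasurableSpace W] {N : ℕ}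
    (m : Fin N → ℕ) (D : Fin N → Measure (Z × W)) [∀ i, IsProbabilityMeasure (D i)] :
    IsProbabilityMeasure (sampleMeasure m D) := by
  unfold sampleMeasure; infer_instance

lemma mp_not : MeasurePreserving (fun b : Bool => !b) (PMF.uniformOfFintype Bool).toMeasure
    (PMF.uniformOfFintype Bool).toMeasure := by
  have hm : Measurable (fun b : Bool => !b) := measurable_of_finite _
  refine ⟨hm, ?_⟩
  refine Measure.ext_of_singleton fun b => ?_
  rw [Measure.map_apply hm (measurableSet_singleton b)]
  have : (fun b : Bool => !b) ⁻¹' {b} = {!b} := by ext x; cases x <;> cases b <;> simp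
  rw [this, PMF.toMeasure_apply_singleton _ _ (measurableSet_singleton _),
    PMF.toMeasure_apply_singleton _ _ (measurableSet_singleton _)]
  simp

lemma mp_radNot (N : ℕ) (m : Fin N → ℕ) :
    MeasurePreserving (fun (σ : (i : Fin N) → Fin (m i) → Bool) i j => !(σ i j))
      (radMeasure N m) (radMeasure N m) := by
  unfold radMeasure
  exact measurePreserving_pi _ _ fun i => measurePreserving_pi _ _ fun j => mp_not

lemma radSign_not (b : Bool) : radSign (!b) = - radSign b := by cases b <;> simp [radSign]

lemma abs_radSign (b : Bool) : |radSign b| = 1 := by cases b <;> simp [radSign]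

/-- Swap of the pair when the sign is `-1`. -/
def swapIf {Z : Type*} (b : Bool) (q : Z × Z) : Z × Z := if b then q else q.swap

lemma mp_swapIf {Z : Type*} [MeasurableSpace Z] (μ : Measure Z) [IsProbabilityMeasure μ] (b : Bool) :
    MeasurePreserving (swapIf b) (μ.prod μ) (μ.prod μ) := by
  cases b
  · exact Measure.measurePreserving_swap
  · exact MeasurePreserving.id _

/-- Coordinatewise conditional swap. -/
def bigSwap {Z : Type*} {N : ℕ} {m : Fin N → ℕ} (σ : (i : Fin N) → Fin (m i) → Bool)
    (q : ((i : Fin N) → Fin (m i) → Z) × ((i : Fin N) → Fin (m i) → Z)) :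
    ((i : Fin N) → Fin (m i) → Z) × ((i : Fin N) → Fin (m i) → Z) :=
  (fun i j => (swapIf (σ i j) (q.1 i j, q.2 i j)).1,
    fun i j => (swapIf (σ i j) (q.1 i j, q.2 i j)).2)

lemma mp_bigSwap {X Y : Type*} [MeasurableSpace X] [MeasurableSpace Y] {N : ℕ} {m : Fin N → ℕ}
    (σ : (i : Fin N) → Fin (m i) → Bool)
    (D : Fin N → Measure (X × Y)) [∀ i, IsProbabilityMeasure (D i)] :
    MeasurePreserving (bigSwap (Z := X × Y) σ) ((sampleMeasure m D).prod (sampleMeasure m D))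
      ((sampleMeasure m D).prod (sampleMeasure m D)) := by
  unfold sampleMeasure
  exact mp_combine _ _ fun i => mp_combine (fun _ : Fin (m i) => D i) _ fun j =>
    mp_swapIf (D i) (σ i j)

/-- Signed weighted sum. -/
def sgnW {Z ι : Type*} {N : ℕ} {m : Fin N → ℕ} (w : Fin N → ℝ) (F : ι → Z → ℝ)
    (σ : (i : Fin N) → Fin (m i) → Bool) (k : ι) (S : (i : Fin N) → Fin (m i) → Z) : ℝ :=
  ∑ i, w i * ∑ j, radSign (σ i j) * F k (S i j)

/-- Weighted sum. -/
def plainW {Z ι : Type*} {N : ℕ} {m : Fin N → ℕ} (w : Fin N → ℝ) (F : ι → Z → ℝ)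
    (k : ι) (S : (i : Fin N) → Fin (m i) → Z) : ℝ :=
  ∑ i, w i * ∑ j, F k (S i j)

lemma bound_sum {N : ℕ} {m : Fin N → ℕ} {w : Fin N → ℝ} (hw : ∀ i, 0 ≤ w i) {M : ℝ}
    (a : (i : Fin N) → Fin (m i) → ℝ) (ha : ∀ i j, |a i j| ≤ M) :
    |∑ i, w i * ∑ j, a i j| ≤ ∑ i, w i * (m i * M) := by
  refine (Finset.abs_sum_le_sum_abs _ _).trans (Finset.sum_le_sum fun i _ => ?_)
  rw [abs_mul, abs_of_nonneg (hw i)]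
  refine mul_le_mul_of_nonneg_left ?_ (hw i)
  refine (Finset.abs_sum_le_sum_abs _ _).trans ?_
  refine (Finset.sum_le_sum fun j _ => ha i j).trans ?_
  simp

lemma plainW_meas {Z ι : Type*} [MeasurableSpace Z] {N : ℕ} {m : Fin N → ℕ} (w : Fin N → ℝ)
    {F : ι → Z → ℝ} (hF : ∀ k, Measurable (F k)) (k : ι) :
    Measurable (plainW (m := m) w F k) := by
  unfold plainW; have := hF k; fun_prop

lemma sgnW_meas {Z ι : Type*} [MeasurableSpace Z] {N : ℕ} {m : Fin N → ℕ} (w : Fin N → ℝ)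
    {F : ι → Z → ℝ} (hF : ∀ k, Measurable (F k)) (σ : (i : Fin N) → Fin (m i) → Bool) (k : ι) :
    Measurable (sgnW (m := m) w F σ k) := by
  unfold sgnW; have := hF k; fun_prop

lemma symm_bound {X Y ι : Type*} [MeasurableSpace X] [MeasurableSpace Y] [Countable ι] [Nonempty ι]
    {N : ℕ} {m : Fin N → ℕ}
    (D : Fin N → Measure (X × Y)) [∀ i, IsProbabilityMeasure (D i)] {w : Fin N → ℝ}
    (hw : ∀ i, 0 ≤ w i) {F : ι → X × Y → ℝ} (hF : ∀ k, Measurable (F k)) {M : ℝ}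
    (hFM : ∀ k z, |F k z| ≤ M) :
    ∫ S, ⨆ k, (∫ S', plainW w F k S' ∂(sampleMeasure m D) - plainW w F k S) ∂(sampleMeasure m D) ≤
      2 * ∫ S, ∫ σ, ⨆ k, sgnW w F σ k S ∂(radMeasure N m) ∂(sampleMeasure m D) := by
  set μ := sampleMeasure m D
  set ρ := radMeasure N m
  set C := ∑ i, w i * (m i * M)
  have hC : ∀ k S, |plainW (m := m) w F k S| ≤ C := fun k S => bound_sum hw _ fun i j => hFM _ _
  have hC' : ∀ σ k S, |sgnW (m := m) w F σ k S| ≤ C := fun σ k S => bound_sum hw _ fun i j => by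
    rw [abs_mul, abs_radSign, one_mul]; exact hFM _ _
  have hneg : ∀ σ k S, - sgnW (m := m) w F σ k S = sgnW w F (fun i j => !(σ i j)) k S := by
    intro σ k S
    simp [sgnW, radSign_not, Finset.sum_neg_distrib]
  have h1 : ∀ σ, ∫ S, ⨆ k, (∫ S', plainW w F k S' ∂μ - plainW w F k S) ∂μ ≤
      ∫ S, ⨆ k, sgnW w F σ k S ∂μ + ∫ S, ⨆ k, sgnW w F (fun i j => !(σ i j)) k S ∂μ := by
    intro σ
    have := sym1 μ (plainW w F) (sgnW w F σ) (plainW_meas w hF) (sgnW_meas w hF σ) C hC (hC' σ)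
      (bigSwap σ) (mp_bigSwap σ D) ?_
    · simpa only [hneg] using this
    · intro k q
      unfold plainW sgnW
      rw [← Finset.sum_sub_distrib, ← Finset.sum_sub_distrib]
      refine Finset.sum_congr rfl fun i _ => ?_
      rw [← mul_sub, ← mul_sub, ← Finset.sum_sub_distrib, ← Finset.sum_sub_distrib]
      congr 1
      refine Finset.sum_congr rfl fun j _ => ?_
      simp only [bigSwap]
      cases σ i j <;> simp [swapIf, radSign]
      ring
  set J : ((i : Fin N) → Fin (m i) → Bool) → ℝ := fun σ => ∫ S, ⨆ k, sgnW w F σ k S ∂μ with hJ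
  have h2 : ∫ S, ⨆ k, (∫ S', plainW w F k S' ∂μ - plainW w F k S) ∂μ ≤
      ∫ σ, (J σ + J (fun i j => !(σ i j))) ∂ρ := by
    have := integral_mono (μ := ρ) (integrable_const _) (Integrable.of_finite) h1
    simpa using this
  rw [integral_add Integrable.of_finite Integrable.of_finite] at h2
  have h3 : ∫ σ, J (fun i j => !(σ i j)) ∂ρ = ∫ σ, J σ ∂ρ := by
    have mp := mp_radNot N m
    conv_rhs => rw [← show _ = ρ from mp.map_eq]
    exact (integral_map mp.measurable.aemeasurable
      (measurable_of_finite J).aestronglyMeasurable).symm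
  have h4 : ∫ σ, J σ ∂ρ = ∫ S, ∫ σ, ⨆ k, sgnW w F σ k S ∂ρ ∂μ := by
    refine integral_integral_swap ?_
    refine integrable_of_bdd (B := C) ?_ fun p => abs_iSup_le_of fun k => hC' _ _ _
    refine measurable_from_prod_countable_right fun σ => ?_
    exact Measurable.iSup fun k => sgnW_meas w hF σ k
  rw [h3, h4] at h2
  linarith

open Classical in
lemma abs_plain_diff {Z : Type*} {m : ℕ} {f : Z → ℝ} {M : ℝ} (h0 : ∀ z, 0 ≤ f z)
    (hM : ∀ z, f z ≤ M) (c : Fin m → ℝ) (hc : ∀ j, |c j| = 1) (S S' : Fin m → Z) :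
    ∑ j, c j * f (S j) - ∑ j, c j * f (S' j) ≤ ∑ j, if S j = S' j then 0 else M := by
  rw [← Finset.sum_sub_distrib]
  refine Finset.sum_le_sum fun j _ => ?_
  split_ifs with hj
  · simp [hj]
  · rw [← mul_sub]
    refine (le_abs_self _).trans ?_
    rw [abs_mul, hc, one_mul]
    exact abs_le.2 ⟨by linarith [h0 (S j), hM (S' j)], by linarith [h0 (S' j), hM (S j)]⟩

open Classical in
lemma sample_subG {X Y : Type*} [MeasurableSpace X] [MeasurableSpace Y] {N : ℕ} (m : Fin N → ℕ)
    (D : Fin N → Measure (X × Y)) [∀ i, IsProbabilityMeasure (D i)] (c : Fin N → ℝ)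
    (hc : ∀ i, 0 ≤ c i) :
    SubG (sampleMeasure m D)
      (fun S S' => ∑ i, ∑ j, if S i j = S' i j then 0 else c i)
      (∑ i, ∑ _j : Fin (m i), c i ^ 2 / 4) := by
  unfold sampleMeasure
  refine SubG.pi _ (fun i (S S' : Fin (m i) → X × Y) => ∑ j, if S j = S' j then 0 else c i)
    (fun i => ∑ _j : Fin (m i), c i ^ 2 / 4) (fun i => ?_) (fun i x => by simp)
  exact SubG.pi (fun _ : Fin (m i) => D i) (fun _ (z z' : X × Y) => if z = z' then 0 else c i)
    (fun _ => c i ^ 2 / 4) (fun j => by convert SubG.base (D i) (c i) (hc i)) (fun i x => by simp)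

lemma SubG.tail {Ω : Type*} [MeasurableSpace Ω] {μ : Measure Ω} [IsProbabilityMeasure μ]
    {d : Ω → Ω → ℝ} {V : ℝ} (hV : 0 < V) (h : SubG μ d V) {f : Ω → ℝ} (hf : Measurable f)
    {B : ℝ} (hB : ∀ x, |f x| ≤ B) (hd : ∀ x y, f x - f y ≤ d x y) (hE : ∫ x, f x ∂μ ≤ 0)
    {ε : ℝ} (hε : 0 ≤ ε) : μ.real {x | ε ≤ f x} ≤ Real.exp (-(ε ^ 2 / (2 * V))) := by
  have ht : 0 ≤ ε / V := by positivity
  refine (ProbabilityTheory.measure_ge_le_exp_mul_mgf ε ht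
    (integrable_of_bdd (by fun_prop) (bdd_exp hB _))).trans ?_
  have h1 := h f hf ⟨B, hB⟩ hd (ε / V)
  unfold ProbabilityTheory.mgf
  refine (mul_le_mul_of_nonneg_left h1 (Real.exp_pos _).le).trans ?_
  rw [← Real.exp_add]
  apply Real.exp_le_exp.2
  have h2 : ε / V * ∫ x, f x ∂μ ≤ 0 := mul_nonpos_of_nonneg_of_nonpos ht hE
  have h3 : -(ε / V) * ε + V * (ε / V) ^ 2 / 2 = -(ε ^ 2 / (2 * V)) := by field_simp; ring
  linarith

/-- Intermediate high-probability bound from the proof of the main theorem. -/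
theorem intermediate_bound {ι : Type*} [Countable ι] [Nonempty ι]
    (L : Y → Y → ℝ) (hLmeas : Measurable (Function.uncurry L))
    (M : ℝ) (hM : 0 < M) (hL0 : ∀ y y', 0 ≤ L y y') (hLM : ∀ y y', L y y' ≤ M)
    (h : ι → X → Y) (hmeas : ∀ k, Measurable (h k))
    {N : ℕ} (D : Fin N → Measure (X × Y)) [∀ i, IsProbabilityMeasure (D i)]
    (DT : Measure (X × Y)) [IsProbabilityMeasure DT]
    (m : Fin N → ℕ) (hm : ∀ i, 1 ≤ m i)
    (α : Fin N → ℝ) (hα : ∀ i, 0 ≤ α i) (hαs : ∑ i, α i = 1)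
    (δ : ℝ) (hδ : 0 < δ)
    (hhat : ((i : Fin N) → Fin (m i) → X × Y) → ι)
    (hhat_min : ∀ S k, empRisk L m α S (h (hhat S)) ≤ empRisk L m α S (h k)) :
    ENNReal.ofReal (1 - δ) ≤
      sampleMeasure m D
        {S | expRisk L DT (h (hhat S)) ≤
          empRisk L m α S (h (hhat S))
          + 2 * ∑ i, α i * radComplexity L h m S i
          + 3 * Real.sqrt (Real.log (4 / δ) * M ^ 2 / 2)
              * Real.sqrt (∑ i, α i ^ 2 / (m i : ℝ))
          + ∑ i, α i * discrepancy L h (D i) DT} := by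
  classical
  by_cases hδ1 : 1 ≤ δ
  · rw [ENNReal.ofReal_of_nonpos (by linarith)]; exact zero_le
  push Not at hδ1
  have hm0 : ∀ i, (0 : ℝ) < m i := fun i => by exact_mod_cast hm i
  set μ := sampleMeasure m D with hμ
  set F : ι → X × Y → ℝ := fun k z => L (h k z.1) z.2 with hFdef
  have hF : ∀ k, Measurable (F k) := fun k =>
    hLmeas.comp (((hmeas k).comp measurable_fst).prodMk measurable_snd)
  have hF0 : ∀ k z, 0 ≤ F k z := fun k z => hL0 _ _
  have hFM : ∀ k z, F k z ≤ M := fun k z => hLM _ _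
  have hFa : ∀ k z, |F k z| ≤ M := fun k z => by rw [abs_of_nonneg (hF0 k z)]; exact hFM k z
  set w : Fin N → ℝ := fun i => α i / m i with hwdef
  have hw : ∀ i, 0 ≤ w i := fun i => div_nonneg (hα i) (hm0 i).le
  set C := ∑ i, w i * (m i * M) with hCdef
  have hC : ∀ k S, |plainW (m := m) w F k S| ≤ C := fun k S => bound_sum hw _ fun i j => hFa _ _
  -- expectation of the weighted sum
  have hE : ∀ k, ∫ S, plainW w F k S ∂μ = ∑ i, α i * expRisk L (D i) (h k) := by
    intro k
    have hmp : ∀ i j, MeasurePreserving (fun S : (i : Fin N) → Fin (m i) → X × Y => S i j)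
        μ (D i) := fun i j =>
      (measurePreserving_eval (fun _ : Fin (m i) => D i) j).comp
        (measurePreserving_eval (fun i => Measure.pi fun _ : Fin (m i) => D i) i)
    have hint : ∀ i j, Integrable (fun S : (i : Fin N) → Fin (m i) → X × Y => F k (S i j)) μ :=
      fun i j => integrable_of_bdd ((hF k).comp (hmp i j).measurable) fun S => hFa k _
    unfold plainW
    rw [integral_finsetSum _ fun i _ => (integrable_finsetSum _ fun j _ => hint i j).const_mul _]
    refine Finset.sum_congr rfl fun i _ => ?_
    rw [integral_const_mul, integral_finsetSum _ fun j _ => hint i j]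
    have : ∀ j, ∫ S, F k (S i j) ∂μ = expRisk L (D i) (h k) := by
      intro j
      unfold expRisk
      conv_rhs => rw [← (hmp i j).map_eq]
      exact (integral_map (hmp i j).measurable.aemeasurable
        (hF k).aestronglyMeasurable).symm
    simp_rw [this]
    have := (hm0 i).ne'
    simp [hwdef]
    field_simp
  set Φ : ((i : Fin N) → Fin (m i) → X × Y) → ℝ :=
    fun S => ⨆ k, (∫ S', plainW w F k S' ∂μ - plainW w F k S) with hΦ
  set G : ((i : Fin N) → Fin (m i) → X × Y) → ℝ :=
    fun S => ∑ i, α i * radComplexity L h m S i with hG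
  have hb3 : ∀ k S, |∫ S', plainW w F k S' ∂μ - plainW w F k S| ≤ 2 * C := fun k x => by
    have := abs_le.1 (hC k x); have := abs_le.1 (abs_integral_le_of (μ := μ) (hC k))
    exact abs_le.2 ⟨by linarith, by linarith⟩
  have hΦm : Measurable Φ := Measurable.iSup fun k =>
    measurable_const.sub (plainW_meas w hF k)
  have hΦB : ∀ S, |Φ S| ≤ 2 * C := fun S => abs_iSup_le_of fun k => hb3 k S
  -- inner supremum
  set r : (i : Fin N) → ((i : Fin N) → Fin (m i) → Bool) → ι →
      ((i : Fin N) → Fin (m i) → X × Y) → ℝ :=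
    fun i σ k S => (1 / (m i : ℝ)) * ∑ j, radSign (σ i j) * F k (S i j) with hr
  have hrB : ∀ i σ k S, |r i σ k S| ≤ M := by
    intro i σ k S
    rw [hr]
    simp only
    rw [abs_mul, abs_of_pos (one_div_pos.2 (hm0 i)), one_div, inv_mul_le_iff₀ (hm0 i)]
    refine (Finset.abs_sum_le_sum_abs _ _).trans ?_
    refine (Finset.sum_le_sum fun j _ => show _ ≤ M from ?_).trans ?_
    · rw [abs_mul, abs_radSign, one_mul]; exact hFa _ _
    · simp
  have hrm : ∀ i σ k, Measurable (r i σ k) := by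
    intro i σ k
    have := hF k
    rw [hr]; fun_prop
  have hR : ∀ S i, radComplexity L h m S i = ∫ σ, ⨆ k, r i σ k S ∂(radMeasure N m) :=
    fun S i => rfl
  have hRB : ∀ S i, |radComplexity L h m S i| ≤ M := fun S i => by
    rw [hR]; exact abs_integral_le_of fun σ => abs_iSup_le_of fun k => hrB i σ k S
  have hRm : ∀ i, Measurable fun S => radComplexity L h m S i := by
    intro i
    simp_rw [hR]
    simp_rw [integral_fintype Integrable.of_finite, smul_eq_mul]
    refine Finset.measurable_sum _ fun σ _ => ?_
    exact (Measurable.iSup fun k => hrm i σ k).const_mul _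
  have hGm : Measurable G := by
    refine Finset.measurable_sum _ fun i _ => (hRm i).const_mul _
  have hGB : ∀ S, |G S| ≤ M := by
    intro S
    refine (Finset.abs_sum_le_sum_abs _ _).trans ?_
    calc ∑ i, |α i * radComplexity L h m S i| ≤ ∑ i, α i * M := by
          refine Finset.sum_le_sum fun i _ => ?_
          rw [abs_mul, abs_of_nonneg (hα i)]
          exact mul_le_mul_of_nonneg_left (hRB S i) (hα i)
      _ = M := by rw [← Finset.sum_mul, hαs, one_mul]
  -- expectation
  have hexp : ∫ S, (Φ S - 2 * G S) ∂μ ≤ 0 := by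
    rw [integral_sub (integrable_of_bdd hΦm hΦB) ((integrable_of_bdd hGm hGB).const_mul 2),
      integral_const_mul]
    have h1 := symm_bound (m := m) D hw hF hFa
    have h2 : ∫ S, ∫ σ, ⨆ k, sgnW w F σ k S ∂(radMeasure N m) ∂μ ≤ ∫ S, G S ∂μ := by
      refine integral_mono ?_ (integrable_of_bdd hGm hGB) fun S => ?_
      · refine integrable_of_bdd (B := C) ?_ fun S => abs_integral_le_of fun σ =>
          abs_iSup_le_of fun k => bound_sum hw _ fun i j => ?_
        · simp_rw [integral_fintype Integrable.of_finite, smul_eq_mul]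
          refine Finset.measurable_sum _ fun σ _ => ?_
          exact (Measurable.iSup fun k => sgnW_meas w hF σ k).const_mul _
        · rw [abs_mul, abs_radSign, one_mul]; exact hFa _ _
      · have e : G S = ∫ σ, ∑ i, α i * ⨆ k, r i σ k S ∂(radMeasure N m) := by
          rw [integral_finsetSum _ fun i _ => Integrable.of_finite]
          simp_rw [integral_const_mul]
          rfl
        rw [e]
        refine integral_mono Integrable.of_finite Integrable.of_finite fun σ => ?_
        refine ciSup_le fun k => ?_
        unfold sgnW
        refine Finset.sum_le_sum fun i _ => ?_
        have h5 : w i * ∑ j, radSign (σ i j) * F k (S i j) = α i * r i σ k S := by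
          rw [hr, hwdef]; simp only; ring
        rw [h5]
        exact mul_le_mul_of_nonneg_left
          (le_ciSup (bddAbove_of_abs fun k => hrB i σ k S) k) (hα i)
    linarith
  -- Lipschitz
  have hΦd : ∀ S S', Φ S - Φ S' ≤ ∑ i, w i * ∑ j, if S i j = S' i j then 0 else M := by
    intro S S'
    refine iSup_sub_le (hb3 · S') fun k => ?_
    have : plainW w F k S' - plainW w F k S ≤
        ∑ i, w i * ∑ j, if S i j = S' i j then 0 else M := by
      unfold plainW
      rw [← Finset.sum_sub_distrib]
      refine Finset.sum_le_sum fun i _ => ?_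
      rw [← mul_sub]
      refine mul_le_mul_of_nonneg_left ?_ (hw i)
      have := abs_plain_diff (hF0 k) (hFM k) (fun _ => 1) (by simp) (S' i) (S i)
      simpa [eq_comm] using this
    linarith
  have hGd : ∀ S S', G S' - G S ≤ ∑ i, w i * ∑ j, if S i j = S' i j then 0 else M := by
    intro S S'
    rw [hG]
    simp only
    rw [← Finset.sum_sub_distrib]
    refine Finset.sum_le_sum fun i _ => ?_
    rw [← mul_sub]
    have h6 : w i * ∑ j, (if S i j = S' i j then 0 else M) =
        α i * ((1 / (m i : ℝ)) * ∑ j, if S i j = S' i j then 0 else M) := by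
      rw [hwdef]; simp only; ring
    rw [h6]
    refine mul_le_mul_of_nonneg_left ?_ (hα i)
    rw [hR, hR, ← integral_sub Integrable.of_finite Integrable.of_finite]
    refine (integral_mono (g := fun _ => (1 / (m i : ℝ)) * ∑ j, if S i j = S' i j then 0 else M)
      Integrable.of_finite (integrable_const _) fun σ => ?_).trans (by simp)
    refine iSup_sub_le (hrB i σ · S) fun k => ?_
    rw [hr]
    simp only
    rw [← mul_sub]
    refine mul_le_mul_of_nonneg_left ?_ (one_div_pos.2 (hm0 i)).le
    have := abs_plain_diff (hF0 k) (hFM k) (fun j => radSign (σ i j))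
      (fun j => abs_radSign _) (S' i) (S i)
    simpa [eq_comm] using this
  set c : Fin N → ℝ := fun i => 3 * M * w i with hc
  have hΨd : ∀ S S', (Φ S - 2 * G S) - (Φ S' - 2 * G S') ≤
      ∑ i, ∑ j, if S i j = S' i j then 0 else c i := by
    intro S S'
    have e : ∑ i, ∑ j, (if S i j = S' i j then 0 else c i) =
        3 * ∑ i, w i * ∑ j, if S i j = S' i j then 0 else M := by
      rw [Finset.mul_sum]
      refine Finset.sum_congr rfl fun i _ => ?_
      rw [Finset.mul_sum, Finset.mul_sum]
      refine Finset.sum_congr rfl fun j _ => ?_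
      split_ifs
      · simp
      · rw [hc]; ring
    rw [e]
    linarith [hΦd S S', hGd S S']
  set s := ∑ i, α i ^ 2 / (m i : ℝ) with hs
  have hs0 : 0 < s := by
    obtain ⟨i, hi⟩ : ∃ i, α i ≠ 0 := by
      by_contra hcon
      push Not at hcon
      simp [hcon] at hαs
    refine Finset.sum_pos' (fun i _ => div_nonneg (sq_nonneg _) (hm0 i).le) ⟨i, Finset.mem_univ _, ?_⟩
    have := hm0 i
    positivity
  set V := ∑ i, ∑ _j : Fin (m i), c i ^ 2 / 4 with hV
  have hVs : V = 9 * M ^ 2 / 4 * s := by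
    rw [hV, hs, Finset.mul_sum]
    refine Finset.sum_congr rfl fun i _ => ?_
    have := (hm0 i).ne'
    simp [hc, hwdef]
    field_simp
    try ring
  have hV0 : 0 < V := by rw [hVs]; positivity
  set ε := 3 * Real.sqrt (Real.log (4 / δ) * M ^ 2 / 2) * Real.sqrt s with hε
  have hlog : 0 ≤ Real.log (4 / δ) := Real.log_nonneg (by rw [le_div_iff₀ hδ]; linarith)
  have hε0 : 0 ≤ ε := by positivity
  have htail := SubG.tail hV0 (sample_subG m D c fun i => by have := hw i; positivity)
    (hΦm.sub (hGm.const_mul 2)) (B := 2 * C + 2 * M)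
    (fun S => by
      have h1 := abs_le.1 (hΦB S); have h2 := abs_le.1 (hGB S)
      exact abs_le.2 ⟨by simp only [Pi.sub_apply]; linarith, by simp only [Pi.sub_apply]; linarith⟩)
    hΨd hexp hε0
  have hval : Real.exp (-(ε ^ 2 / (2 * V))) = δ / 4 := by
    have : ε ^ 2 / (2 * V) = Real.log (4 / δ) := by
      rw [hε, mul_pow, mul_pow, Real.sq_sqrt (by positivity), Real.sq_sqrt hs0.le, hVs]
      field_simp
      try ring
    rw [this, ← Real.log_inv, Real.exp_log (by positivity), inv_div]
  rw [hval] at htail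
  have hmeasbad : MeasurableSet {S | ε ≤ Φ S - 2 * G S} :=
    measurableSet_le measurable_const (hΦm.sub (hGm.const_mul 2))
  have hgood : ENNReal.ofReal (1 - δ) ≤ μ {S | ε ≤ Φ S - 2 * G S}ᶜ := by
    rw [← ofReal_measureReal]
    apply ENNReal.ofReal_le_ofReal
    rw [probReal_compl_eq_one_sub hmeasbad]
    have : μ.real {S | ε ≤ Φ S - 2 * G S} ≤ δ / 4 := htail
    linarith
  refine hgood.trans (measure_mono fun S hS => ?_)
  simp only [Set.mem_compl_iff, Set.mem_ofPred_eq, not_le] at hS ⊢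
  set k := hhat S
  have h1 : (∑ i, α i * expRisk L (D i) (h k)) - empRisk L m α S (h k) ≤ Φ S := by
    have := le_ciSup (bddAbove_of_abs (hb3 · S)) k
    rw [hE] at this
    exact this
  have hEB : ∀ (P : Measure (X × Y)) [IsProbabilityMeasure P] k, |expRisk L P (h k)| ≤ M :=
    fun P _ k => abs_integral_le_of fun z => hFa k z
  have h2 : expRisk L DT (h k) ≤ ∑ i, α i * expRisk L (D i) (h k) +
      ∑ i, α i * discrepancy L h (D i) DT := by
    rw [← Finset.sum_add_distrib]
    calc expRisk L DT (h k) = ∑ i, α i * expRisk L DT (h k) := by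
          rw [← Finset.sum_mul, hαs, one_mul]
      _ ≤ _ := by
          refine Finset.sum_le_sum fun i _ => ?_
          rw [← mul_add]
          refine mul_le_mul_of_nonneg_left ?_ (hα i)
          have h3 : |expRisk L (D i) (h k) - expRisk L DT (h k)| ≤ discrepancy L h (D i) DT := by
            refine le_ciSup (f := fun k => |expRisk L (D i) (h k) - expRisk L DT (h k)|)
              ⟨2 * M, ?_⟩ k
            rintro _ ⟨k, rfl⟩
            have h4 := abs_le.1 (hEB (D i) k); have h5 := abs_le.1 (hEB DT k)
            exact abs_le.2 ⟨by linarith, by linarith⟩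
          linarith [(abs_le.1 h3).1]
  have h7 : ∑ i, α i * radComplexity L h m S i = G S := rfl
  rw [h7]
  linarith

end
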